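/- arXiv:math/0401098 — 3 statements merged into one kernel-verified Lean document; each statement's English description precedes it below -/
import Mathlib

section
/- Let A be a finitely generated, connected graded k-algebra that is infinite dimensional over k. Then there exists a graded two-sided ideal J ⊂ A such that the quotient A/J is projectively simple. -/
/-!
STATEMENT 3: Let `A` be a finitely generated, connected graded `k`-algebra that is
infinite dimensional over `k`.  Then there exists a graded two-sided ideal `J ⊆ A`
such that `A/J` is projectively simple.

Since the graded two-sided ideals of `A/J` correspond exactly to the graded two-sided
ideals of `A` containing `J`, projective simplicity of the quotient `A/J` is rendered
as: `dim_k A/J = ∞`, and every graded two-sided ideal `I` with `J < I` satisfies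
`dim_k A/I < ∞`.
-/

/-- The underlying `k`-submodule of a two-sided ideal of a `k`-algebra. -/
def TwoSidedIdeal.ksub (k : Type*) {A : Type*} [CommSemiring k] [Ring A] [Algebra k A]
    (I : TwoSidedIdeal A) : Submodule k A where
  carrier := I
  add_mem' := fun ha hb => I.add_mem ha hb
  zero_mem' := I.zero_mem
  smul_mem' := fun c x hx => by
    rw [Algebra.smul_def]
    exact I.mul_mem_left _ _ hx

/-- In a finitely generated algebra, having finite codimension is witnessed by finitely many
elements of the two-sided ideal. -/
theorem TwoSidedIdeal.exists_finset_forall_finiteDimensional (k : Type*) {A : Type*} [Field k]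
    [Ring A] [Algebra k A] (hfg : Algebra.FiniteType k A) (I : TwoSidedIdeal A)
    (hI : FiniteDimensional k (A ⧸ I.ksub k)) :
    ∃ R : Finset A, (∀ r ∈ R, r ∈ I) ∧
      ∀ J : TwoSidedIdeal A, (∀ r ∈ R, r ∈ J) → FiniteDimensional k (A ⧸ J.ksub k) := by
  classical
  obtain ⟨S, hS⟩ := hfg.out
  obtain ⟨W₀, hW₀⟩ := hI.fg_top
  choose g hg using (I.ksub k).mkQ_surjective
  set T : Finset A := W₀.image g with hT
  have hsup (a : A) : ∃ w ∈ Submodule.span k (T : Set A), a - w ∈ I := by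
    have hmap : Submodule.map (I.ksub k).mkQ (Submodule.span k (T : Set A)) = ⊤ := by
      rw [Submodule.map_span, hT, Finset.coe_image, Set.image_image]
      simpa [hg] using hW₀
    obtain ⟨w, hw, hwa⟩ := hmap.ge (Submodule.mem_top (x := (I.ksub k).mkQ a))
    exact ⟨w, hw, (Submodule.Quotient.eq (I.ksub k)).1 hwa.symm⟩
  choose w hw hwI using hsup
  refine ⟨insert (1 - w 1) ((S ×ˢ T).image fun p => p.1 * p.2 - w (p.1 * p.2)), ?_, ?_⟩
  · intro r hr
    rcases Finset.mem_insert.1 hr with rfl | hr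
    · exact hwI 1
    · obtain ⟨p, -, rfl⟩ := Finset.mem_image.1 hr
      exact hwI _
  · intro J hJ
    set M := Submodule.span k (T : Set A) ⊔ J.ksub k with hM
    have mem_of (a : A) (ha : a - w a ∈ J) : a ∈ M :=
      Submodule.mem_sup.2 ⟨w a, hw a, a - w a, ha, by abel⟩
    have hone : (1 : A) ∈ M := mem_of 1 (hJ _ (Finset.mem_insert_self _ _))
    have hgen : ∀ s ∈ S, M ≤ M.comap (LinearMap.mulLeft k s) := by
      intro s hs
      refine sup_le (Submodule.span_le.2 fun t ht => ?_) fun x hx => ?_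
      · exact mem_of _ (hJ _ (Finset.mem_insert_of_mem
          (Finset.mem_image.2 ⟨(s, t), Finset.mem_product.2 ⟨hs, ht⟩, rfl⟩)))
      · exact Submodule.mem_sup_right (J.mul_mem_left s x hx)
    have hmul (a : A) : ∀ m ∈ M, a * m ∈ M := by
      have ha : a ∈ Algebra.adjoin k (S : Set A) := hS ▸ Algebra.mem_top
      induction ha using Algebra.adjoin_induction with
      | mem s hs => exact fun m hm => hgen s hs hm
      | algebraMap c =>
        intro m hm
        rw [← Algebra.smul_def]
        exact M.smul_mem c hm
      | add a b _ _ iha ihb =>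
        intro m hm
        rw [add_mul]
        exact M.add_mem (iha m hm) (ihb m hm)
      | mul a b _ _ iha ihb =>
        intro m hm
        rw [mul_assoc]
        exact iha _ (ihb m hm)
    refine ⟨⟨T.image (J.ksub k).mkQ, ?_⟩⟩
    rw [Finset.coe_image, ← Submodule.map_span, eq_top_iff]
    rintro q -
    obtain ⟨a, rfl⟩ := (J.ksub k).mkQ_surjective q
    have ha : a ∈ M := by simpa using hmul a 1 hone
    obtain ⟨u, hu, v, hv, rfl⟩ := Submodule.mem_sup.1 ha
    refine ⟨u, hu, (Submodule.Quotient.eq _).2 ?_⟩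
    simpa using hv

/-- The union of a nonempty chain of two-sided ideals. -/
theorem TwoSidedIdeal.exists_mem_iff_of_isChain {A : Type*} [Ring A] {c : Set (TwoSidedIdeal A)}
    (hc : IsChain (· ≤ ·) c) (hne : c.Nonempty) :
    ∃ U : TwoSidedIdeal A, ∀ x, x ∈ U ↔ ∃ I ∈ c, x ∈ I := by
  obtain ⟨I₀, hI₀⟩ := hne
  refine ⟨.mk' {x | ∃ I ∈ c, x ∈ I} ⟨I₀, hI₀, I₀.zero_mem⟩ ?_ ?_ ?_ ?_, fun x => ?_⟩
  · rintro x y ⟨I, hI, hx⟩ ⟨J, hJ, hy⟩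
    rcases hc.total hI hJ with h | h
    · exact ⟨J, hJ, J.add_mem (h hx) hy⟩
    · exact ⟨I, hI, I.add_mem hx (h hy)⟩
  · rintro x ⟨I, hI, hx⟩
    exact ⟨I, hI, I.neg_mem hx⟩
  · rintro x y ⟨I, hI, hy⟩
    exact ⟨I, hI, I.mul_mem_left x y hy⟩
  · rintro x y ⟨I, hI, hx⟩
    exact ⟨I, hI, I.mul_mem_right x y hx⟩
  · exact TwoSidedIdeal.mem_mk' ..

/-- A finite subset of the union of a nonempty chain of two-sided ideals lies in one of them. -/
theorem TwoSidedIdeal.exists_mem_chain_of_finset {A : Type*} [Ring A]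
    {c : Set (TwoSidedIdeal A)} (hc : IsChain (· ≤ ·) c) (hne : c.Nonempty) (R : Finset A)
    (hR : ∀ r ∈ R, ∃ I ∈ c, r ∈ I) : ∃ I ∈ c, ∀ r ∈ R, r ∈ I := by
  classical
  induction R using Finset.induction_on with
  | empty => exact hne.imp fun I hI => ⟨hI, by simp⟩
  | insert a R _ ih =>
    obtain ⟨I, hI, hIR⟩ := ih fun r hr => hR r (Finset.mem_insert_of_mem hr)
    obtain ⟨J, hJ, haJ⟩ := hR a (Finset.mem_insert_self a R)
    rcases hc.total hI hJ with h | h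
    · exact ⟨J, hJ, Finset.forall_mem_insert .. |>.2 ⟨haJ, fun r hr => h (hIR r hr)⟩⟩
    · exact ⟨I, hI, Finset.forall_mem_insert .. |>.2 ⟨h haJ, hIR⟩⟩

theorem exists_projectively_simple_quotient
    (k : Type*) {A : Type*} [Field k] [Ring A] [Algebra k A]
    (𝒜 : ℕ → Submodule k A) [GradedAlgebra 𝒜]
    (hconn : 𝒜 0 = (1 : Submodule k A))
    (hfg : Algebra.FiniteType k A)
    (hinf : ¬ FiniteDimensional k A) :
    ∃ J : TwoSidedIdeal A,
      (∀ x ∈ J, ∀ n, (DirectSum.decompose 𝒜 x n : A) ∈ J) ∧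
      ¬ FiniteDimensional k (A ⧸ J.ksub k) ∧
      ∀ I : TwoSidedIdeal A,
        (∀ x ∈ I, ∀ n, (DirectSum.decompose 𝒜 x n : A) ∈ I) → J < I →
        FiniteDimensional k (A ⧸ I.ksub k) := by
  obtain ⟨J, hJ⟩ := zorn_le₀ {J : TwoSidedIdeal A |
      (∀ x ∈ J, ∀ n, (DirectSum.decompose 𝒜 x n : A) ∈ J) ∧
      ¬ FiniteDimensional k (A ⧸ J.ksub k)} <| by
    intro c hcs hc
    rcases c.eq_empty_or_nonempty with rfl | hne
    · refine ⟨⊥, ⟨fun x hx n => ?_, fun h => hinf ?_⟩, by simp⟩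
      · rw [TwoSidedIdeal.mem_bot] at hx ⊢
        simp [hx]
      · have hbot : (⊥ : TwoSidedIdeal A).ksub k = ⊥ := by
          ext x
          exact TwoSidedIdeal.mem_bot A
        exact Module.Finite.equiv (Submodule.quotEquivOfEqBot _ hbot)
    · obtain ⟨U, hU⟩ := TwoSidedIdeal.exists_mem_iff_of_isChain hc hne
      refine ⟨U, ⟨fun x hx n => ?_, fun hfin => ?_⟩, fun I hI x hx => (hU x).2 ⟨I, hI, hx⟩⟩
      · obtain ⟨I, hI, hxI⟩ := (hU x).1 hx
        exact (hU _).2 ⟨I, hI, (hcs hI).1 x hxI n⟩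
      · obtain ⟨R, hRU, hR⟩ := U.exists_finset_forall_finiteDimensional k hfg hfin
        obtain ⟨I, hI, hRI⟩ := TwoSidedIdeal.exists_mem_chain_of_finset hc hne R
          fun r hr => (hU r).1 (hRU r hr)
        exact (hcs hI).2 (hR I hRI)
  refine ⟨J, hJ.prop.1, hJ.prop.2, fun I hI hlt => ?_⟩
  by_contra hfin
  exact hlt.not_ge (hJ.le_of_ge ⟨hI, hfin⟩ hlt.le)
end

section
/- Let A be a noetherian projectively simple k-algebra, and let M and N be graded (A,A)-bimodules, each noetherian on both sides, such that neither M nor N is torsion as a right A-module. Then the space of right A-module homomorphisms of all degrees, ⊕_{n∈ℤ} Hom_{gr-A}(M, N(n)) (where N(n) denotes the n-th degree shift and Hom_{gr-A} denotes degree-preserving right A-module maps), is infinite dimensional over k. -/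
/-- Projective simplicity of a locally finite ℕ-graded `k`-algebra. -/
def ProjectivelySimple (k : Type*) {A : Type*} [Field k] [Ring A] [Algebra k A]
    (𝒜 : ℕ → Submodule k A) [GradedAlgebra 𝒜] : Prop :=
  ¬ FiniteDimensional k A ∧
  ∀ I : TwoSidedIdeal A, I ≠ ⊥ →
    (∀ x ∈ I, ∀ n, (DirectSum.decompose 𝒜 x n : A) ∈ I) →
    FiniteDimensional k (A ⧸ I.ksub k)

section NoetherianPrime

variable {R : Type*} [Ring R]

/-- A left ideal `E` is essential if every nonzero element has a nonzero multiple in `E`. -/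
def IsEssentialIdeal (E : Submodule R R) : Prop :=
  ∀ a : R, a ≠ 0 → ∃ r : R, r * a ∈ E ∧ r * a ≠ 0

theorem IsEssentialIdeal.mono {E F : Submodule R R} (hE : IsEssentialIdeal E) (h : E ≤ F) :
    IsEssentialIdeal F := fun a ha =>
  let ⟨r, hr, hr0⟩ := hE a ha
  ⟨r, h hr, hr0⟩

theorem IsEssentialIdeal.inf {E F : Submodule R R} (hE : IsEssentialIdeal E)
    (hF : IsEssentialIdeal F) : IsEssentialIdeal (E ⊓ F) := fun a ha => by
  obtain ⟨r, hr, hr0⟩ := hE a ha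
  obtain ⟨s, hs, hs0⟩ := hF _ hr0
  refine ⟨s * r, ⟨?_, ?_⟩, ?_⟩
  · rw [mul_assoc]; exact E.smul_mem s hr
  · rwa [mul_assoc]
  · rwa [mul_assoc]

theorem isEssentialIdeal_top : IsEssentialIdeal (⊤ : Submodule R R) :=
  fun a ha => ⟨1, trivial, by rwa [one_mul]⟩

theorem IsEssentialIdeal.comap_toSpanSingleton {E : Submodule R R} (hE : IsEssentialIdeal E)
    (y : R) : IsEssentialIdeal (E.comap (LinearMap.toSpanSingleton R R y)) := fun a ha => by
  by_cases hy : a * y = 0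
  · exact ⟨1, by simp [hy], by simpa using ha⟩
  · obtain ⟨r, hr, hr0⟩ := hE _ hy
    refine ⟨r, by simpa [mul_assoc] using hr, fun h => hr0 ?_⟩
    rw [← mul_assoc, h, zero_mul]

/-- In a prime left noetherian ring, every nonzero left ideal has a non-nilpotent element. -/
theorem exists_not_isNilpotent [IsNoetherianRing R]
    (hp : ∀ a b : R, (∀ x, a * x * b = 0) → a = 0 ∨ b = 0)
    {K : Submodule R R} (hK : K ≠ ⊥) : ∃ a ∈ K, ¬ IsNilpotent a := by
  by_contra! hnil
  obtain ⟨a₀, ha₀K, ha₀⟩ := (Submodule.ne_bot_iff K).1 hK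
  let ann : R → Submodule R R := fun a => LinearMap.ker (LinearMap.toSpanSingleton R R a)
  have mem_ann : ∀ a r, r ∈ ann a ↔ r * a = 0 := fun a r => by simp [ann]
  have hnil' : ∀ x, IsNilpotent (a₀ * x) := fun x => by
    obtain ⟨n, hn⟩ := hnil (x * a₀) (K.smul_mem x ha₀K)
    refine ⟨n + 1, ?_⟩
    have : (a₀ * x) ^ (n + 1) = a₀ * (x * a₀) ^ n * x := by
      clear hn
      induction n with
      | zero => simp
      | succ n ih => rw [pow_succ, ih, pow_succ]; simp only [mul_assoc]
    rw [this, hn]; simp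
  obtain ⟨_, ⟨a, ⟨⟨y, rfl⟩, ha⟩, rfl⟩, hmax⟩ := set_has_maximal_iff_noetherian.2
    (inferInstanceAs (IsNoetherian R R)) (ann '' {a | (∃ y, a = a₀ * y) ∧ a ≠ 0})
    ⟨_, a₀, ⟨⟨1, by simp⟩, ha₀⟩, rfl⟩
  have key : ∀ u, (a₀ * y) * u * (a₀ * y) = 0 := fun u => by
    by_cases hu : a₀ * y * u = 0
    · rw [hu, zero_mul]
    have hn := hnil' (y * u)
    rw [← mul_assoc] at hn
    set b := a₀ * y * u with hb
    classical
    obtain ⟨n, hn0, hn1⟩ : ∃ n, b ^ n ≠ 0 ∧ b ^ (n + 1) = 0 := by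
      have hk := Nat.find_spec hn
      have : Nat.find hn ≠ 0 := fun h => by
        rw [h, pow_zero] at hk
        exact hu (by rw [← one_mul b, hk, zero_mul])
      obtain ⟨n, hn'⟩ := Nat.exists_eq_succ_of_ne_zero this
      exact ⟨n, Nat.find_min hn (by omega), by rw [← Nat.succ_eq_add_one, ← hn']; exact hk⟩
    have hpos : n ≠ 0 := fun h => by
      rw [h] at hn1
      exact hu (by simpa using hn1)
    obtain ⟨m, rfl⟩ := Nat.exists_eq_succ_of_ne_zero hpos
    have hle : ann (a₀ * y) ≤ ann (b ^ (m + 1)) := fun r hr => by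
      rw [mem_ann] at hr ⊢
      rw [pow_succ', hb, ← mul_assoc, ← mul_assoc r, hr]; simp
    have hnl := hmax _ ⟨b ^ (m + 1), ⟨⟨y * u * b ^ m, by
      rw [pow_succ']; nth_rewrite 1 [hb]; simp only [mul_assoc]⟩, hn0⟩, rfl⟩
    have heq : ann (b ^ (m + 1)) ≤ ann (a₀ * y) := by
      by_contra h
      exact hnl (lt_of_le_not_ge hle h)
    exact (mem_ann _ _).1 (heq ((mem_ann _ _).2 (by rw [← pow_succ']; exact hn1)))
  exact (or_self_iff.1 (hp _ _ key)) |> ha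

theorem exists_ne_zero_of_mul_self_mul [IsNoetherianRing R]
    (hp : ∀ a b : R, (∀ x, a * x * b = 0) → a = 0 ∨ b = 0)
    {K : Submodule R R} (hK : K ≠ ⊥) :
    ∃ a ∈ K, a ≠ 0 ∧ ∀ x, x * a * a = 0 → x * a = 0 := by
  obtain ⟨a, haK, ha⟩ := exists_not_isNilpotent hp hK
  let f : ℕ →o Submodule R R :=
    ⟨fun n => LinearMap.ker (LinearMap.toSpanSingleton R R (a ^ n)), monotone_nat_of_le_succ
      fun n r hr => by
        simp only [LinearMap.mem_ker, LinearMap.toSpanSingleton_apply, smul_eq_mul] at hr ⊢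
        rw [pow_succ, ← mul_assoc, hr, zero_mul]⟩
  obtain ⟨n, hn⟩ := monotone_stabilizes_iff_noetherian.2 (inferInstanceAs (IsNoetherian R R)) f
  have hn' : ∀ m, n ≤ m → ∀ x, x * a ^ m = 0 → x * a ^ n = 0 := fun m hm x hx => by
    have : x ∈ f m := by simpa [f] using hx
    rw [← hn m hm] at this
    simpa [f] using this
  refine ⟨a ^ (n + 1), ?_, fun h => ha ⟨_, h⟩, fun x hx => ?_⟩
  · rw [pow_succ]; exact K.smul_mem _ haK
  · rw [mul_assoc, ← pow_add] at hx
    rw [pow_succ, ← mul_assoc, hn' _ (by omega) x hx, zero_mul]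

/-- The left singular ideal of a prime left noetherian ring vanishes. -/
theorem IsEssentialIdeal.eq_zero [IsNoetherianRing R]
    (hp : ∀ a b : R, (∀ x, a * x * b = 0) → a = 0 ∨ b = 0)
    {E : Submodule R R} (hE : IsEssentialIdeal E) {x : R} (hx : ∀ e ∈ E, e * x = 0) : x = 0 := by
  by_contra hx0
  have hK : Submodule.span R {x} ≠ ⊥ := by simpa using hx0
  obtain ⟨z, hz, hz0, hzz⟩ := exists_ne_zero_of_mul_self_mul hp hK
  obtain ⟨y, rfl⟩ := Submodule.mem_span_singleton.1 hz
  obtain ⟨r, hr, hr0⟩ := hE.comap_toSpanSingleton y _ hz0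
  refine hr0 (hzz r ?_)
  have := hx _ hr
  simpa [mul_assoc] using this

theorem isEssentialIdeal_span_singleton [IsNoetherianRing R] {c : R}
    (hc : ∀ x, x * c = 0 → x = 0) : IsEssentialIdeal (Submodule.span R {c}) := fun a ha => by
  by_contra! h
  let f : R × Submodule.span R {a} →ₗ[R] R :=
    (LinearMap.toSpanSingleton R R c).coprod (Submodule.subtype _)
  have hf : Function.Injective f := by
    rw [← LinearMap.ker_eq_bot, LinearMap.ker_eq_bot']
    rintro ⟨x, y, hy⟩ hxy
    obtain ⟨r, rfl⟩ := Submodule.mem_span_singleton.1 hy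
    simp only [f, LinearMap.coprod_apply, LinearMap.toSpanSingleton_apply, smul_eq_mul,
      Submodule.subtype_apply] at hxy
    have hra : r * a = 0 := h r (Submodule.mem_span_singleton.2
      ⟨-x, by rw [smul_eq_mul, neg_mul]; exact (eq_neg_of_add_eq_zero_right hxy).symm⟩)
    rw [hra, add_zero] at hxy
    simp [hc x hxy, hra]
  have e := IsNoetherian.equivPUnitOfProdInjective f hf
  have h0 : (⟨a, Submodule.mem_span_singleton_self a⟩ : Submodule.span R {a}) = 0 :=
    e.injective (Subsingleton.elim _ _)
  exact ha (congrArg Subtype.val h0)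

/-- Right cancellable elements of a prime left noetherian ring are left cancellable. -/
theorem eq_zero_of_mul_eq_zero_of_forall [IsNoetherianRing R]
    (hp : ∀ a b : R, (∀ x, a * x * b = 0) → a = 0 ∨ b = 0)
    {c : R} (hc : ∀ x, x * c = 0 → x = 0) {x : R} (hx : c * x = 0) : x = 0 :=
  (isEssentialIdeal_span_singleton hc).eq_zero hp fun e he => by
    obtain ⟨r, rfl⟩ := Submodule.mem_span_singleton.1 he
    rw [smul_eq_mul, mul_assoc, hx, mul_zero]

/-- Goldie: an essential left ideal of a prime noetherian ring contains a regular element. -/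
theorem IsEssentialIdeal.exists_mul_eq_zero [IsNoetherianRing R] [IsNoetherianRing Rᵐᵒᵖ]
    (hp : ∀ a b : R, (∀ x, a * x * b = 0) → a = 0 ∨ b = 0)
    {E : Submodule R R} (hE : IsEssentialIdeal E) : ∃ c ∈ E, ∀ x, x * c = 0 → x = 0 := by
  let rann : R → Submodule Rᵐᵒᵖ Rᵐᵒᵖ := fun c =>
    { carrier := {y | ∀ x, x * c = 0 → x * y.unop = 0}
      add_mem' := fun ha hb x hx => by simp [mul_add, ha x hx, hb x hx]
      zero_mem' := fun x _ => by simp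
      smul_mem' := fun r y hy x hx => by simp [← mul_assoc, hy x hx] }
  obtain ⟨_, ⟨c, ⟨hcE, hcc⟩, rfl⟩, hmax⟩ := set_has_maximal_iff_noetherian.2
    (inferInstanceAs (IsNoetherian Rᵐᵒᵖ Rᵐᵒᵖ))
    (rann '' {c | c ∈ E ∧ ∀ x, x * c * c = 0 → x * c = 0})
    ⟨_, 0, ⟨E.zero_mem, by simp⟩, rfl⟩
  refine ⟨c, hcE, fun x hx => by_contra fun hx0 => ?_⟩
  obtain ⟨r, hrE, hr0⟩ := hE x hx0
  have hK : E ⊓ LinearMap.ker (LinearMap.toSpanSingleton R R c) ≠ ⊥ :=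
    (Submodule.ne_bot_iff _).2 ⟨r * x, ⟨hrE, by simp [mul_assoc, hx]⟩, hr0⟩
  obtain ⟨a, ⟨haE, hac⟩, ha0, haa⟩ := exists_ne_zero_of_mul_self_mul hp hK
  replace hac : a * c = 0 := by simpa using hac
  have hsplit : ∀ x, x * (c + a) * (c + a) = 0 → x * c = 0 ∧ x * a = 0 := fun x hx => by
    have h1 : x * c * c + x * c * a + x * a * a = 0 := by
      have : x * (c + a) * (c + a) = x * c * c + x * c * a + x * (a * c) + x * a * a := by
        noncomm_ring
      rw [this, hac] at hx; simpa using hx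
    have h2 : x * c * c * c = 0 := by
      have : (x * c * c + x * c * a + x * a * a) * c
          = x * c * c * c + x * c * (a * c) + x * a * (a * c) := by noncomm_ring
      rw [h1, hac] at this; simpa using this.symm
    have h3 : x * c = 0 := hcc _ (hcc _ h2)
    rw [h3] at h1
    exact ⟨h3, haa _ (by simpa using h1)⟩
  have hle : rann c ≤ rann (c + a) := fun y hy x hx =>
    hy x (hsplit x (by rw [hx, zero_mul])).1
  have hnl := hmax _ ⟨c + a, ⟨E.add_mem hcE haE, fun x hx => by
    rw [mul_add, (hsplit x hx).1, (hsplit x hx).2, add_zero]⟩, rfl⟩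
  have hge : rann (c + a) ≤ rann c := by
    by_contra h
    exact hnl (lt_of_le_not_ge hle h)
  have hmem : MulOpposite.op a ∈ rann (c + a) := fun x hx =>
    (hsplit x (by rw [hx, zero_mul])).2
  have haa0 : a * a = 0 := hge hmem a hac
  exact ha0 (by simpa using haa 1 (by simpa using haa0))

/-- The elementwise form of primeness passes to the opposite ring. -/
theorem MulOpposite.eq_zero_or_eq_zero_of_forall
    (hp : ∀ a b : R, (∀ x, a * x * b = 0) → a = 0 ∨ b = 0) (a b : Rᵐᵒᵖ)
    (h : ∀ x, a * x * b = 0) : a = 0 ∨ b = 0 := by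
  have := hp b.unop a.unop fun x => by
    have := congrArg MulOpposite.unop (h (MulOpposite.op x))
    simpa [mul_assoc] using this
  simpa [or_comm] using this

end NoetherianPrime

section Extension

variable {R : Type*} [Ring R] {M : Type*} [AddCommGroup M] [Module R M]

theorem LinearMap.exists_extend_sup_span_singleton {P : Type*} [AddCommGroup P] [Module R P]
    {W : Submodule R M} (φ : W →ₗ[R] P) (v : M) (y : P)
    (h : ∀ (a : R) (ha : a • v ∈ W), φ ⟨a • v, ha⟩ = a • y) :
    ∃ ψ : ↥(W ⊔ Submodule.span R {v}) →ₗ[R] P,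
      (∀ w (hw : w ∈ W), ψ ⟨w, Submodule.mem_sup_left hw⟩ = φ ⟨w, hw⟩) ∧
      ψ ⟨v, Submodule.mem_sup_right (Submodule.mem_span_singleton_self v)⟩ = y := by
  have hv : ∀ c : R, c • v = 0 → (RingHom.id R) c • y = 0 := fun c hc => by
    have hc' : c • v ∈ W := by rw [hc]; exact W.zero_mem
    have h0 : (⟨c • v, hc'⟩ : W) = 0 := Subtype.ext hc
    rw [RingHom.id_apply, ← h c hc', h0, map_zero]
  let f : M →ₗ.[R] P := ⟨W, φ⟩
  let g : M →ₗ.[R] P := LinearPMap.mkSpanSingleton' v y hv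
  have hfg : ∀ (a : f.domain) (b : g.domain), (a : M) = b → f a = g b := by
    rintro ⟨a, ha⟩ ⟨b, hb⟩ (rfl : a = b)
    obtain ⟨c, rfl⟩ := Submodule.mem_span_singleton.1 hb
    rw [LinearPMap.mkSpanSingleton'_apply]
    exact h c ha
  refine ⟨(f.sup g hfg).toFun, fun w hw => ?_, ?_⟩
  · exact ((LinearPMap.left_le_sup f g hfg).2 (x := ⟨w, hw⟩) rfl).symm
  · refine ((LinearPMap.right_le_sup f g hfg).2
      (x := ⟨v, Submodule.mem_span_singleton_self v⟩) rfl).symm.trans ?_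
    exact LinearPMap.mkSpanSingleton'_apply_self _ _ _ _

variable (R) in
/-- The left ideal of scalars moving `m` into `W`. -/
def Submodule.transporter (W : Submodule R M) (m : M) : Submodule R R :=
  W.comap (LinearMap.toSpanSingleton R M m)

@[simp]
theorem Submodule.mem_transporter {W : Submodule R M} {m : M} {r : R} :
    r ∈ W.transporter R m ↔ r • m ∈ W := Iff.rfl

/-- Over a prime ring which is noetherian on both sides, a noetherian module with an element
whose annihilator is not essential has a nonzero linear functional. -/
theorem exists_linearMap_ne_zero [IsNoetherianRing R] [IsNoetherianRing Rᵐᵒᵖ] [IsNoetherian R M]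
    (hp : ∀ a b : R, (∀ x, a * x * b = 0) → a = 0 ∨ b = 0)
    {m₀ : M} (hm₀ : ¬ IsEssentialIdeal ((⊥ : Submodule R M).transporter R m₀)) :
    ∃ g : M →ₗ[R] R, g ≠ 0 := by
  have : IsNoetherianRing Rᵐᵒᵖᵐᵒᵖ := isNoetherianRing_of_ringEquiv R (RingEquiv.opOp R)
  have hp' := MulOpposite.eq_zero_or_eq_zero_of_forall hp
  -- start from a functional on a submodule with singular quotient
  obtain ⟨K, ⟨m, hm⟩, hKmax⟩ := set_has_maximal_iff_noetherian.2 ‹IsNoetherian R M›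
    {K : Submodule R M | ∃ m, ¬ IsEssentialIdeal (K.transporter R m)} ⟨⊥, m₀, hm₀⟩
  obtain ⟨a, ha0, ha⟩ : ∃ a : R, a ≠ 0 ∧ ∀ r, r • a • m ∈ K → r * a = 0 := by
    simp only [IsEssentialIdeal, not_forall, not_exists] at hm
    obtain ⟨a, ha0, ha⟩ := hm
    refine ⟨a, ha0, fun r hr => by_contra fun h => ha r ⟨?_, h⟩⟩
    rwa [Submodule.mem_transporter, mul_smul]
  have ham : a • m ∉ K := fun h => ha0 (by simpa using ha 1 (by simpa using h))
  obtain ⟨φ₀, -, hφ₀⟩ := LinearMap.exists_extend_sup_span_singleton (0 : K →ₗ[R] R) (a • m) a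
    fun r hr => by simp [ha r hr]
  have hsing : ∀ v, IsEssentialIdeal ((K ⊔ Submodule.span R {a • m}).transporter R v) := fun v => by
    by_contra h
    exact hKmax _ ⟨v, h⟩ (by simpa using ham)
  -- extend it as far as possible
  obtain ⟨W, ⟨hW, φ, hφ⟩, hWmax⟩ := set_has_maximal_iff_noetherian.2 ‹IsNoetherian R M›
    {W : Submodule R M | (∀ v, IsEssentialIdeal (W.transporter R v)) ∧ ∃ φ : W →ₗ[R] R, φ ≠ 0}
    ⟨_, hsing, φ₀, fun h => ha0 (by rw [← hφ₀, h]; rfl)⟩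
  suffices hWtop : W = ⊤ by
    subst hWtop
    refine ⟨φ ∘ₗ Submodule.topEquiv.symm.toLinearMap, fun h => hφ ?_⟩
    ext x
    exact LinearMap.congr_fun h x.1
  by_contra hWtop
  obtain ⟨v, hv⟩ : ∃ v, v ∉ W := by
    by_contra! h
    exact hWtop (eq_top_iff.2 fun v _ => h v)
  obtain ⟨c, hcW, hc⟩ := (hW v).exists_mul_eq_zero hp
  rw [Submodule.mem_transporter] at hcW
  have hcl := isEssentialIdeal_span_singleton hc
  have hcr : IsEssentialIdeal (Submodule.span Rᵐᵒᵖ {MulOpposite.op c}) :=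
    isEssentialIdeal_span_singleton fun x hx => by
      have := eq_zero_of_mul_eq_zero_of_forall hp hc (x := x.unop)
        (by simpa using congrArg MulOpposite.unop hx)
      simpa using this
  -- a common denominator
  set d := φ ⟨c • v, hcW⟩ with hd
  have hEss := hcr.comap_toSpanSingleton (MulOpposite.op d)
  obtain ⟨x, hx, hx0⟩ := hEss.exists_mul_eq_zero hp'
  obtain ⟨b, hb⟩ := Submodule.mem_span_singleton.1 hx
  have hdx : d * x.unop = c * b.unop := by
    simpa using (congrArg MulOpposite.unop hb).symm
  have hxl : ∀ z : R, z * x.unop = 0 → z = 0 := fun z hz => by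
    have := eq_zero_of_mul_eq_zero_of_forall hp' hx0 (x := MulOpposite.op z)
      (MulOpposite.unop_injective (by simpa using hz))
    simpa using this
  let φ' : W →ₗ[R] R := LinearMap.toSpanSingleton R R x.unop ∘ₗ φ
  have hφ'_apply : ∀ w, φ' w = φ w * x.unop := fun w => rfl
  obtain ⟨ψ, hψ, -⟩ := LinearMap.exists_extend_sup_span_singleton φ' v b.unop fun r hr => by
    obtain ⟨e, he, he0⟩ := (hcl.comap_toSpanSingleton r).exists_mul_eq_zero hp
    obtain ⟨y, hy⟩ := Submodule.mem_span_singleton.1 he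
    replace hy : y * c = e * r := by simpa using hy
    have h1 : e * φ ⟨r • v, hr⟩ = y * d := by
      rw [hd, ← smul_eq_mul, ← map_smul, ← smul_eq_mul, ← map_smul]
      congr 1
      ext
      change e • r • v = y • c • v
      rw [smul_smul, smul_smul, hy]
    rw [← sub_eq_zero]
    apply eq_zero_of_mul_eq_zero_of_forall hp he0
    rw [hφ'_apply, smul_eq_mul, mul_sub, ← mul_assoc, h1, mul_assoc, hdx, ← mul_assoc, hy,
      mul_assoc, sub_self]
  refine hWmax (W ⊔ Submodule.span R {v}) ⟨fun u => (hW u).mono fun r hr => ?_, ψ, fun h => hφ ?_⟩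
    (by simpa using hv)
  · exact Submodule.mem_sup_left (Submodule.mem_transporter.1 hr)
  · ext w
    refine hxl _ ?_
    rw [← hφ'_apply, ← hψ w.1 w.2, h]
    rfl

end Extension

section GradedAlgebra

open DirectSum

variable {k A : Type*} [Field k] [Ring A] [Algebra k A] (𝒜 : ℕ → Submodule k A) [GradedAlgebra 𝒜]

/-- The elements all of whose components of degree less than `n` vanish. -/
def gradedTail (n : ℕ) : Submodule k A where
  carrier := {a | ∀ i < n, (decompose 𝒜 a i : A) = 0}
  add_mem' := fun ha hb i hi => by simp [decompose_add, ha i hi, hb i hi]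
  zero_mem' := fun i _ => by simp
  smul_mem' := fun c a ha i hi => by simp [decompose_smul, DirectSum.smul_apply, ha i hi]

variable {𝒜}

theorem mem_gradedTail_of_mem {n m : ℕ} (h : n ≤ m) {a : A} (ha : a ∈ 𝒜 m) :
    a ∈ gradedTail 𝒜 n := fun i hi => decompose_of_mem_ne 𝒜 ha (by omega)

theorem coe_decompose_mul_of_mem_gradedTail {p q : ℕ} {a b : A} (ha : a ∈ gradedTail 𝒜 p)
    (hb : b ∈ gradedTail 𝒜 q) :
    (decompose 𝒜 (a * b) (p + q) : A) = decompose 𝒜 a p * decompose 𝒜 b q := by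
  rw [decompose_mul, coe_mul_apply_eq_sum_antidiagonal, Finset.sum_eq_single (p, q)]
  · rintro ⟨i, j⟩ hij hne
    rw [Finset.HasAntidiagonal.mem_antidiagonal] at hij
    simp only at hij ⊢
    rcases lt_or_ge i p with h | h
    · rw [ha i h, zero_mul]
    · have : j < q := by
        by_contra hj
        exact hne (by ext <;> simp only <;> omega)
      rw [hb j this, mul_zero]
  · intro h
    exact (h (Finset.HasAntidiagonal.mem_antidiagonal.2 rfl)).elim

theorem exists_mem_gradedTail {a : A} (ha : a ≠ 0) :
    ∃ p, a ∈ gradedTail 𝒜 p ∧ (decompose 𝒜 a p : A) ≠ 0 := by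
  classical
  have h : ∃ p, (decompose 𝒜 a p : A) ≠ 0 := by
    by_contra! h
    refine ha ((decompose 𝒜).injective ?_)
    ext i
    simp [h i]
  exact ⟨Nat.find h, fun i hi => by simpa using Nat.find_min h hi, Nat.find_spec h⟩

/-- A statement about `A` that is additive need only be checked on homogeneous elements. -/
theorem GradedAlgebra.forall_of_homogeneous (𝒜 : ℕ → Submodule k A) [GradedAlgebra 𝒜]
    {P : Type*} [AddCommGroup P] (f : A →+ P)
    (h : ∀ n, ∀ a ∈ 𝒜 n, f a = 0) (a : A) : f a = 0 := by
  induction a using Decomposition.inductionOn 𝒜 with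
  | zero => exact map_zero f
  | homogeneous a => exact h _ a a.2
  | add a b ha hb => rw [map_add, ha, hb, add_zero]

/-- A graded ideal of finite codimension contains all components of large degree. -/
theorem exists_forall_mem_of_finiteDimensional_quotient (I : TwoSidedIdeal A)
    (hI : ∀ x ∈ I, ∀ n, (decompose 𝒜 x n : A) ∈ I) (hfin : FiniteDimensional k (A ⧸ I.ksub k)) :
    ∃ n₀, ∀ n, n₀ ≤ n → ∀ a ∈ 𝒜 n, a ∈ I := by
  let f : ℕ →o (Submodule k (A ⧸ I.ksub k))ᵒᵈ :=
    ⟨fun n => OrderDual.toDual ((gradedTail 𝒜 n).map (I.ksub k).mkQ), fun n m h =>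
      OrderDual.toDual_le_toDual.2 (Submodule.map_mono fun a ha i hi => ha i (by omega))⟩
  obtain ⟨n₀, hn₀⟩ := IsArtinian.monotone_stabilizes f
  refine ⟨n₀, fun n hn a ha => ?_⟩
  have h1 : (I.ksub k).mkQ a ∈ (gradedTail 𝒜 n₀).map (I.ksub k).mkQ :=
    Submodule.mem_map_of_mem (mem_gradedTail_of_mem hn ha)
  have h2 : (gradedTail 𝒜 n₀).map (I.ksub k).mkQ = (gradedTail 𝒜 (n + 1)).map (I.ksub k).mkQ :=
    OrderDual.toDual.injective (hn₀ (n + 1) (by omega))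
  rw [h2] at h1
  obtain ⟨b, hb, hab⟩ := h1
  have h3 : a - b ∈ I := (Submodule.Quotient.eq (I.ksub k)).1 hab.symm
  have h4 := hI _ h3 n
  rw [decompose_sub, DirectSum.sub_apply, AddSubgroupClass.coe_sub, hb n (by omega), sub_zero,
    decompose_of_mem_same 𝒜 ha] at h4
  exact h4

theorem ProjectivelySimple.exists_forall_mem (hps : ProjectivelySimple k 𝒜) {I : TwoSidedIdeal A}
    {a : A} (ha : a ∈ I) (ha0 : a ≠ 0) (hI : ∀ x ∈ I, ∀ n, (decompose 𝒜 x n : A) ∈ I) :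
    ∃ n₀, ∀ n, n₀ ≤ n → ∀ a ∈ 𝒜 n, a ∈ I :=
  exists_forall_mem_of_finiteDimensional_quotient I hI
    (hps.2 I (fun h => ha0 (by rw [h] at ha; exact ha)) hI)

theorem finiteDimensional_of_eventually_eq_zero (hlf : ∀ n, FiniteDimensional k (𝒜 n)) {n₀ : ℕ}
    (h : ∀ n, n₀ ≤ n → ∀ a ∈ 𝒜 n, a = 0) : FiniteDimensional k A := by
  have htop : (⊤ : Submodule k A) = (Finset.range n₀).sup 𝒜 := by
    refine (eq_top_iff.2 fun a _ => ?_).symm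
    induction a using Decomposition.inductionOn 𝒜 with
    | zero => exact zero_mem _
    | @homogeneous i a =>
      by_cases hi : i < n₀
      · exact Finset.le_sup (f := 𝒜) (Finset.mem_range.2 hi) a.2
      · rw [h i (by omega) a a.2]; exact zero_mem _
    | add a b ha hb => exact add_mem (ha trivial) (hb trivial)
  have : FiniteDimensional k (⊤ : Submodule k A) := by
    rw [htop]; infer_instance
  exact Module.Finite.equiv (Submodule.topEquiv (R := k) (M := A))

/-- In an infinite-dimensional noetherian locally finite graded algebra, the product of two
irrelevant tails is never zero. -/
theorem exists_mul_ne_zero_of_tails [IsNoetherianRing A] (hlf : ∀ n, FiniteDimensional k (𝒜 n))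
    (hinf : ¬ FiniteDimensional k A) (p q : ℕ) :
    ∃ i j, p ≤ i ∧ q ≤ j ∧ ∃ a ∈ 𝒜 i, ∃ b ∈ 𝒜 j, a * b ≠ 0 := by
  by_contra! h
  let L : ℕ →o Submodule A A :=
    ⟨fun m => Submodule.span A {z | ∃ n, q ≤ n ∧ n ≤ m ∧ z ∈ 𝒜 n}, fun m m' hm =>
      Submodule.span_mono fun z ⟨n, h1, h2, h3⟩ => ⟨n, h1, h2.trans hm, h3⟩⟩
  obtain ⟨m, hm⟩ := monotone_stabilizes_iff_noetherian.2 (inferInstanceAs (IsNoetherian A A)) L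
  have hL : ∀ z ∈ L m, ∀ n, p + m ≤ n → (decompose 𝒜 z n : A) = 0 := fun z hz => by
    induction hz using Submodule.closure_induction with
    | zero => simp
    | add x y _ _ hx hy => intro n hn; simp [decompose_add, hx n hn, hy n hn]
    | smul_mem r x hx =>
      obtain ⟨j, hj, hjm, hxj⟩ := hx
      intro n hn
      rw [smul_eq_mul, coe_decompose_mul_of_right_mem_of_le 𝒜 hxj (by omega)]
      exact h _ _ (by omega) hj _ (SetLike.coe_mem _) _ hxj
  refine hinf (finiteDimensional_of_eventually_eq_zero hlf (n₀ := p + q + m) fun n hn a ha => ?_)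
  have haL : a ∈ L m := by
    rw [hm n (by omega)]
    exact Submodule.subset_span ⟨n, by omega, le_rfl, ha⟩
  rw [← decompose_of_mem_same 𝒜 ha]
  exact hL a haL n (by omega)

theorem ProjectivelySimple.eq_zero_or_eq_zero_of_homogeneous [IsNoetherianRing A]
    (hps : ProjectivelySimple k 𝒜) (hlf : ∀ n, FiniteDimensional k (𝒜 n)) {p : ℕ} {a b : A}
    (ha : a ∈ 𝒜 p) (hab : ∀ x, a * x * b = 0) : a = 0 ∨ b = 0 := by
  by_contra! h0
  let J : TwoSidedIdeal A := TwoSidedIdeal.mk' {y | ∀ x, a * x * y = 0} (fun x => by simp)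
    (fun hx hy z => by rw [mul_add, hx, hy, add_zero]) (fun hx z => by rw [mul_neg, hx, neg_zero])
    (fun {x y} hy z => by simpa [mul_assoc] using hy (z * x))
    (fun {x y} hx z => by rw [← mul_assoc, hx, zero_mul])
  have hJ : ∀ y, y ∈ J ↔ ∀ x, a * x * y = 0 := fun y => TwoSidedIdeal.mem_mk' _ _ _ _ _ _ _
  obtain ⟨n₀, hn₀⟩ := hps.exists_forall_mem ((hJ b).2 hab) h0.2 fun y hy n => (hJ _).2 fun x => by
    rw [hJ] at hy
    refine GradedAlgebra.forall_of_homogeneous 𝒜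
      ((AddMonoidHom.mulRight (decompose 𝒜 y n : A)).comp (AddMonoidHom.mulLeft a))
      (fun j x hx => ?_) x
    have := coe_decompose_mul_add_of_left_mem 𝒜 (j := n) (b := y) (SetLike.mul_mem_graded ha hx)
    rw [hy x, decompose_zero] at this
    exact this.symm
  let I : TwoSidedIdeal A := TwoSidedIdeal.mk' {y | ∀ n, n₀ ≤ n → ∀ z ∈ 𝒜 n, y * z = 0}
    (fun n _ z _ => zero_mul z) (fun hx hy n hn z hz => by
      rw [add_mul, hx n hn z hz, hy n hn z hz, add_zero])
    (fun hx n hn z hz => by rw [neg_mul, hx n hn z hz, neg_zero])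
    (fun {x y} hy n hn z hz => by rw [mul_assoc, hy n hn z hz, mul_zero])
    (fun {x y} hx n hn z hz => by
      refine GradedAlgebra.forall_of_homogeneous 𝒜
        ((AddMonoidHom.mulRight z).comp (AddMonoidHom.mulLeft x)) (fun j y hy => ?_) y
      exact (mul_assoc _ _ _).trans (hx (j + n) (by omega) _ (SetLike.mul_mem_graded hy hz)))
  have hI : ∀ y, y ∈ I ↔ ∀ n, n₀ ≤ n → ∀ z ∈ 𝒜 n, y * z = 0 :=
    fun y => TwoSidedIdeal.mem_mk' _ _ _ _ _ _ _
  have haI : a ∈ I := (hI a).2 fun n hn z hz => by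
    simpa using (hJ z).1 (hn₀ n hn z hz) 1
  obtain ⟨n₁, hn₁⟩ := hps.exists_forall_mem haI h0.1 fun y hy i => (hI _).2 fun n hn z hz => by
    have := coe_decompose_mul_add_of_right_mem 𝒜 (i := i) (a := y) hz
    rw [(hI y).1 hy n hn z hz, decompose_zero] at this
    exact this.symm
  obtain ⟨i, j, hi, hj, x, hx, y, hy, hxy⟩ := exists_mul_ne_zero_of_tails hlf hps.1 n₁ n₀
  exact hxy ((hI x).1 (hn₁ i hi x hx) j hj y hy)

/-- A noetherian projectively simple algebra is prime. -/
theorem ProjectivelySimple.eq_zero_or_eq_zero [IsNoetherianRing A]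
    (hps : ProjectivelySimple k 𝒜) (hlf : ∀ n, FiniteDimensional k (𝒜 n)) (a b : A)
    (hab : ∀ x, a * x * b = 0) : a = 0 ∨ b = 0 := by
  by_contra! h0
  obtain ⟨p, hap, hap0⟩ := exists_mem_gradedTail (𝒜 := 𝒜) h0.1
  obtain ⟨q, hbq, hbq0⟩ := exists_mem_gradedTail (𝒜 := 𝒜) h0.2
  refine (hps.eq_zero_or_eq_zero_of_homogeneous hlf (SetLike.coe_mem (decompose 𝒜 a p))
    fun x => ?_).elim hap0 hbq0
  refine GradedAlgebra.forall_of_homogeneous 𝒜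
    ((AddMonoidHom.mulRight (decompose 𝒜 b q : A)).comp
      (AddMonoidHom.mulLeft (decompose 𝒜 a p : A))) (fun j x hx => ?_) x
  have hax : a * x ∈ gradedTail 𝒜 (p + j) := fun i hi => by
    by_cases hij : j ≤ i
    · rw [coe_decompose_mul_of_right_mem_of_le 𝒜 hx hij, hap _ (by omega), zero_mul]
    · rw [coe_decompose_mul_of_right_mem_of_not_le 𝒜 hx hij]
  have := coe_decompose_mul_of_mem_gradedTail hax hbq
  rw [hab, decompose_zero, coe_decompose_mul_add_of_right_mem 𝒜 hx] at this
  exact this.symm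

end GradedAlgebra

section GradedModule

open DirectSum MulOpposite

variable {k A : Type*} [Field k] [Ring A] [Algebra k A] {𝒜 : ℕ → Submodule k A}
  {M : Type*} [AddCommGroup M] [Module k M] [Module Aᵐᵒᵖ M]
  {ℳ : ℤ → Submodule k M} [Decomposition ℳ]
  {N : Type*} [AddCommGroup N] [Module k N] [Module Aᵐᵒᵖ N]
  {𝒩 : ℤ → Submodule k N} [Decomposition 𝒩]

theorem coe_decompose_op_smul
    (hMA : ∀ (n : ℤ) (j : ℕ), ∀ x ∈ ℳ n, ∀ a ∈ 𝒜 j, op a • x ∈ ℳ (n + (j : ℤ)))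
    {j : ℕ} {a : A} (ha : a ∈ 𝒜 j) (x : M) (n : ℤ) :
    (decompose ℳ (op a • x) (n + j) : M) = op a • (decompose ℳ x n : M) := by
  induction x using Decomposition.inductionOn ℳ with
  | zero => simp
  | @homogeneous i x =>
    by_cases hij : i = n
    · subst hij
      rw [decompose_of_mem_same ℳ x.2, decompose_of_mem_same ℳ (hMA _ j x x.2 a ha)]
    · rw [decompose_of_mem_ne ℳ x.2 hij, decompose_of_mem_ne ℳ (hMA _ j x x.2 a ha) (by omega),
        smul_zero]
  | add x y hx hy => simp [decompose_add, hx, hy]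

variable [GradedAlgebra 𝒜]

theorem coe_decompose_op_smul_of_mem
    (hMA : ∀ (n : ℤ) (j : ℕ), ∀ x ∈ ℳ n, ∀ a ∈ 𝒜 j, op a • x ∈ ℳ (n + (j : ℤ)))
    {n : ℤ} {x : M} (hx : x ∈ ℳ n) (a : A) (i : ℕ) :
    (decompose ℳ (op a • x) (n + i) : M) = op (decompose 𝒜 a i : A) • x := by
  induction a using Decomposition.inductionOn 𝒜 with
  | zero => simp
  | @homogeneous j a =>
    by_cases hij : j = i
    · subst hij
      rw [decompose_of_mem_same 𝒜 a.2, decompose_of_mem_same ℳ (hMA n j x hx a a.2)]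
    · rw [decompose_of_mem_ne 𝒜 a.2 hij, decompose_of_mem_ne ℳ (hMA n j x hx a a.2) (by omega),
        op_zero, zero_smul]
  | add a b ha hb => simp [decompose_add, add_smul, ha, hb]

/-- A graded right module over a projectively simple algebra which is not torsion is faithful. -/
theorem ProjectivelySimple.eq_zero_of_forall_smul_eq_zero (hps : ProjectivelySimple k 𝒜)
    (hMA : ∀ (n : ℤ) (j : ℕ), ∀ x ∈ ℳ n, ∀ a ∈ 𝒜 j, op a • x ∈ ℳ (n + (j : ℤ)))
    (hM : ¬ (∀ x : M, ∃ n0 : ℕ, ∀ m : ℕ, n0 ≤ m → ∀ a ∈ 𝒜 m, op a • x = 0))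
    {t : Aᵐᵒᵖ} (ht : ∀ x : M, t • x = 0) : t = 0 := by
  by_contra ht0
  let I : TwoSidedIdeal A := TwoSidedIdeal.mk' {a | ∀ x : M, op a • x = 0} (fun x => by simp)
    (fun ha hb x => by rw [op_add, add_smul, ha, hb, add_zero])
    (fun ha x => by rw [op_neg, neg_smul, ha, neg_zero])
    (fun {a b} hb x => by rw [op_mul, mul_smul, hb])
    (fun {a b} ha x => by rw [op_mul, mul_smul, ha, smul_zero])
  have hI : ∀ a, a ∈ I ↔ ∀ x : M, op a • x = 0 := fun a => TwoSidedIdeal.mem_mk' _ _ _ _ _ _ _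
  obtain ⟨n₀, hn₀⟩ := hps.exists_forall_mem ((hI t.unop).2 ht)
    (fun h => ht0 (unop_injective h)) fun a ha i => (hI _).2 fun x => by
      induction x using Decomposition.inductionOn ℳ with
      | zero => simp
      | @homogeneous n x =>
        rw [← coe_decompose_op_smul_of_mem hMA x.2, (hI a).1 ha]; simp
      | add x y hx hy => rw [smul_add, hx, hy, add_zero]
  exact hM fun x => ⟨n₀, fun m hm a ha => (hI a).1 (hn₀ m hm a ha) x⟩

variable (ℳ 𝒩) in
/-- The degree `d` component of a map between graded modules, as an additive map. -/
def homComponent (f : M →+ N) (d : ℤ) : M →+ N :=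
  (DirectSum.toAddMonoid fun i => (((𝒩 (d + i)).subtype.toAddMonoidHom.comp
    ((DFinsupp.evalAddMonoidHom (d + i)).comp (decomposeAddEquiv 𝒩).toAddMonoidHom)).comp f).comp
      (ℳ i).subtype.toAddMonoidHom).comp (decomposeAddEquiv ℳ).toAddMonoidHom

theorem homComponent_apply_of_mem (f : M →+ N) (d : ℤ) {i : ℤ} {x : M} (hx : x ∈ ℳ i) :
    homComponent ℳ 𝒩 f d x = decompose 𝒩 (f x) (d + i) := by
  change DirectSum.toAddMonoid _ (decompose ℳ x) = _
  rw [decompose_of_mem ℳ hx, DirectSum.toAddMonoid_of]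
  rfl

theorem homComponent_op_smul
    (hMA : ∀ (n : ℤ) (j : ℕ), ∀ x ∈ ℳ n, ∀ a ∈ 𝒜 j, op a • x ∈ ℳ (n + (j : ℤ)))
    (hNA : ∀ (n : ℤ) (j : ℕ), ∀ x ∈ 𝒩 n, ∀ a ∈ 𝒜 j, op a • x ∈ 𝒩 (n + (j : ℤ)))
    (f : M →ₗ[Aᵐᵒᵖ] N) (d : ℤ) (a : A) (x : M) :
    homComponent ℳ 𝒩 f.toAddMonoidHom d (op a • x)
      = op a • homComponent ℳ 𝒩 f.toAddMonoidHom d x := by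
  induction x using Decomposition.inductionOn ℳ with
  | zero => simp
  | add x y hx hy => rw [smul_add, map_add, map_add, smul_add, hx, hy]
  | @homogeneous i x =>
    induction a using Decomposition.inductionOn 𝒜 with
    | zero => simp
    | add a b ha hb => rw [op_add, add_smul, map_add, add_smul, ha, hb]
    | @homogeneous j a =>
      rw [homComponent_apply_of_mem _ _ (hMA i j x x.2 a a.2), homComponent_apply_of_mem _ _ x.2,
        ← coe_decompose_op_smul hNA a.2, add_assoc]
      simp

theorem exists_forall_sum_homComponent (f : M →+ N) (x : M) :
    ∃ D₀ : Finset ℤ, ∀ D, D₀ ⊆ D → ∑ d ∈ D, homComponent ℳ 𝒩 f d x = f x := by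
  classical
  induction x using Decomposition.inductionOn ℳ with
  | zero => exact ⟨∅, by simp⟩
  | add x y hx hy =>
    obtain ⟨D₁, h₁⟩ := hx
    obtain ⟨D₂, h₂⟩ := hy
    refine ⟨D₁ ∪ D₂, fun D hD => ?_⟩
    simp only [map_add, Finset.sum_add_distrib]
    rw [h₁ D (Finset.union_subset_left hD), h₂ D (Finset.union_subset_right hD)]
  | @homogeneous i x =>
    refine ⟨(decompose 𝒩 (f x)).support.image fun n => n - i, fun D hD => ?_⟩
    have h1 : ∑ d ∈ D, homComponent ℳ 𝒩 f d x
        = ∑ n ∈ D.map (addRightEmbedding i), (decompose 𝒩 (f x) n : N) := by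
      rw [Finset.sum_map]
      exact Finset.sum_congr rfl fun d _ => homComponent_apply_of_mem f d x.2
    rw [h1]
    refine Eq.trans (Finset.sum_subset (fun n hn => ?_) fun n _ hn => ?_).symm
      (sum_support_decompose 𝒩 (f x))
    · exact Finset.mem_map.2 ⟨n - i, hD (Finset.mem_image_of_mem _ hn), by simp⟩
    · rw [DFinsupp.notMem_support_iff.1 hn]; rfl

/-- Every right module map out of a noetherian graded module is a sum of homogeneous ones. -/
theorem mem_span_homogeneous [SMulCommClass Aᵐᵒᵖ k N] [IsNoetherian Aᵐᵒᵖ M]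
    (hMA : ∀ (n : ℤ) (j : ℕ), ∀ x ∈ ℳ n, ∀ a ∈ 𝒜 j, op a • x ∈ ℳ (n + (j : ℤ)))
    (hNA : ∀ (n : ℤ) (j : ℕ), ∀ x ∈ 𝒩 n, ∀ a ∈ 𝒜 j, op a • x ∈ 𝒩 (n + (j : ℤ)))
    (f : M →ₗ[Aᵐᵒᵖ] N) :
    f ∈ Submodule.span k
      {f : M →ₗ[Aᵐᵒᵖ] N | ∃ d : ℤ, ∀ i : ℤ, ∀ x ∈ ℳ i, f x ∈ 𝒩 (d + i)} := by
  classical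
  let F : ℤ → M →ₗ[Aᵐᵒᵖ] N := fun d =>
    { homComponent ℳ 𝒩 f.toAddMonoidHom d with
      map_smul' := fun a x => homComponent_op_smul hMA hNA f d a.unop x }
  have hF : ∀ d x, F d x = homComponent ℳ 𝒩 f.toAddMonoidHom d x := fun d x => rfl
  obtain ⟨S, hS⟩ := IsNoetherian.noetherian (⊤ : Submodule Aᵐᵒᵖ M)
  choose D hD using exists_forall_sum_homComponent (ℳ := ℳ) (𝒩 := 𝒩) f.toAddMonoidHom
  have hsum : f = ∑ d ∈ S.biUnion D, F d := by
    refine LinearMap.ext_on hS fun x hx => ?_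
    rw [LinearMap.sum_apply]
    exact (hD x _ (Finset.subset_biUnion_of_mem D hx)).symm
  rw [hsum]
  refine Submodule.sum_mem _ fun d _ => Submodule.subset_span ⟨d, fun i x hx => ?_⟩
  rw [hF, homComponent_apply_of_mem _ _ hx]
  exact SetLike.coe_mem _

end GradedModule

section Bimodule

open MulOpposite

/-- If all annihilators in a bimodule, finitely generated over the other side, are essential, then
the whole bimodule is annihilated by a nonzero element. -/
theorem exists_ne_zero_forall_smul_eq_zero {A R M : Type*} [Ring A] [Ring R] [Nontrivial R]
    [AddCommGroup M] [Module A M] [Module R M] [SMulCommClass A R M] [IsNoetherian A M]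
    (h : ∀ m : M, IsEssentialIdeal ((⊥ : Submodule R M).transporter R m)) :
    ∃ s : R, s ≠ 0 ∧ ∀ m : M, s • m = 0 := by
  classical
  obtain ⟨S, hS⟩ := IsNoetherian.noetherian (⊤ : Submodule A M)
  have hinf : IsEssentialIdeal (S.inf ((⊥ : Submodule R M).transporter R)) := by
    clear hS
    induction S using Finset.induction_on with
    | empty => exact isEssentialIdeal_top
    | insert m S _ ih => rw [Finset.inf_insert]; exact (h m).inf ih
  obtain ⟨s, hs, hs0⟩ := hinf 1 one_ne_zero
  refine ⟨s * 1, hs0, fun m => ?_⟩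
  have hm : m ∈ Submodule.span A (S : Set M) := by rw [hS]; trivial
  induction hm using Submodule.span_induction with
  | mem m hm => exact (Finset.inf_le (f := (⊥ : Submodule R M).transporter R) hm) hs
  | zero => exact smul_zero _
  | add x y _ _ hx hy => rw [smul_add, hx, hy, add_zero]
  | smul a x _ hx => rw [← smul_comm, hx, smul_zero]

/-- A prime algebra with a nonzero finite-dimensional principal right ideal is
finite-dimensional. -/
theorem finiteDimensional_of_range_mulLeft {k R : Type*} [Field k] [Ring R] [Algebra k R]
    (hp : ∀ a b : R, (∀ x, a * x * b = 0) → a = 0 ∨ b = 0) {j : R} (hj : j ≠ 0)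
    (hfin : FiniteDimensional k (LinearMap.range (LinearMap.mulLeft k j))) :
    FiniteDimensional k R := by
  let D := LinearMap.range (LinearMap.mulLeft k j)
  have hD : ∀ (d : D) (s : R), d.1 * s ∈ D := by
    rintro ⟨_, r, rfl⟩ s
    exact ⟨r * s, by simp [mul_assoc]⟩
  let ψ : R →ₗ[k] D →ₗ[k] D := LinearMap.mk₂ k (fun s d => ⟨d.1 * s, hD d s⟩)
    (fun s t d => Subtype.ext (mul_add _ _ _)) (fun c s d => Subtype.ext (mul_smul_comm _ _ _))
    (fun s d e => Subtype.ext (add_mul _ _ _)) (fun c s d => Subtype.ext (smul_mul_assoc _ _ _))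
  have : FiniteDimensional k D := hfin
  suffices hψ : Function.Injective ψ from Module.Finite.of_injective ψ hψ
  refine (injective_iff_map_eq_zero ψ).2 fun s hs => ?_
  refine (hp j s fun x => ?_).resolve_left hj
  exact congrArg Subtype.val (LinearMap.congr_fun hs ⟨j * x, x, rfl⟩)

/-- Let `N` be a bimodule, finitely generated over `A` and faithful over the prime algebra `R`.
If some module over `R` has a nonzero functional and only a finite-dimensional space of maps
to `N`, then `R` is finite-dimensional. -/
theorem finiteDimensional_of_finiteDimensional_linearMap {k A R M N : Type*} [Field k] [Ring A]
    [Ring R] [Algebra k R] [AddCommGroup M] [Module R M]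
    [AddCommGroup N] [Module k N] [Module A N] [Module R N] [IsScalarTower k R N]
    [SMulCommClass A R N] [SMulCommClass R k N] [IsNoetherian A N]
    (hp : ∀ a b : R, (∀ x, a * x * b = 0) → a = 0 ∨ b = 0)
    (hN : ∀ t : R, (∀ y : N, t • y = 0) → t = 0)
    {g : M →ₗ[R] R} (hg : g ≠ 0) (hfin : FiniteDimensional k (M →ₗ[R] N)) :
    FiniteDimensional k R := by
  obtain ⟨m, hm⟩ : ∃ m, g m ≠ 0 := by
    by_contra! h
    exact hg (LinearMap.ext h)
  let ev : (M →ₗ[R] N) →ₗ[k] N :=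
    { toFun := fun f => f m
      map_add' := fun _ _ => rfl
      map_smul' := fun _ _ => rfl }
  let D := LinearMap.range (LinearMap.mulLeft k (g m))
  have hD : ∀ (d : D) (y : N), d.1 • y ∈ LinearMap.range ev := by
    rintro ⟨_, r, rfl⟩ y
    exact ⟨LinearMap.toSpanSingleton R N (r • y) ∘ₗ g, by simp [ev, mul_smul]⟩
  obtain ⟨S, hS⟩ := IsNoetherian.noetherian (⊤ : Submodule A N)
  let θ : D →ₗ[k] S → LinearMap.range ev :=
    { toFun := fun d y => ⟨d.1 • y.1, hD d y⟩
      map_add' := fun d e => funext fun y => Subtype.ext (add_smul _ _ _)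
      map_smul' := fun c d => funext fun y => Subtype.ext (smul_assoc _ _ _) }
  refine finiteDimensional_of_range_mulLeft hp hm
    (FiniteDimensional.of_injective θ ((injective_iff_map_eq_zero θ).2 fun d hd => ?_))
  refine Subtype.ext (hN _ fun y => ?_)
  have hy : y ∈ Submodule.span A (S : Set N) := by rw [hS]; trivial
  induction hy using Submodule.span_induction with
  | mem y hy => exact congrArg Subtype.val (congrFun hd ⟨y, hy⟩)
  | zero => exact smul_zero _
  | add x y _ _ hx hy => rw [smul_add, hx, hy, add_zero]
  | smul a x _ hx => rw [← smul_comm, hx, smul_zero]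

end Bimodule

theorem hom_space_between_nontorsion_bimodules_infinite_dimensional
    (k : Type*) [Field k]
    -- `A`: a noetherian (on both sides) projectively simple graded `k`-algebra
    {A : Type*} [Ring A] [Algebra k A]
    (𝒜 : ℕ → Submodule k A) [GradedAlgebra 𝒜]
    (hlfA : ∀ n, FiniteDimensional k (𝒜 n))
    (hNoethA : IsNoetherianRing A) (hNoethAop : IsNoetherianRing Aᵐᵒᵖ)
    (hps : ProjectivelySimple k 𝒜)
    -- `M`: a graded `(A,A)`-bimodule, noetherian on both sides
    {M : Type*} [AddCommGroup M] [Module k M]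
    [Module A M] [IsScalarTower k A M]
    [Module Aᵐᵒᵖ M] [IsScalarTower k Aᵐᵒᵖ M] [SMulCommClass A Aᵐᵒᵖ M]
    (ℳ : ℤ → Submodule k M) [DirectSum.Decomposition ℳ]
    (hAM : ∀ (i : ℕ) (n : ℤ), ∀ a ∈ 𝒜 i, ∀ x ∈ ℳ n, a • x ∈ ℳ ((i : ℤ) + n))
    (hMA : ∀ (n : ℤ) (j : ℕ), ∀ x ∈ ℳ n, ∀ a ∈ 𝒜 j, MulOpposite.op a • x ∈ ℳ (n + (j : ℤ)))
    (hNoethM : IsNoetherian A M) (hNoethMop : IsNoetherian Aᵐᵒᵖ M)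
    -- `N`: a graded `(A,A)`-bimodule, noetherian on both sides
    {N : Type*} [AddCommGroup N] [Module k N]
    [Module A N] [IsScalarTower k A N]
    [Module Aᵐᵒᵖ N] [IsScalarTower k Aᵐᵒᵖ N] [SMulCommClass A Aᵐᵒᵖ N]
    [SMulCommClass Aᵐᵒᵖ k N]
    (𝒩 : ℤ → Submodule k N) [DirectSum.Decomposition 𝒩]
    (hAN : ∀ (i : ℕ) (n : ℤ), ∀ a ∈ 𝒜 i, ∀ x ∈ 𝒩 n, a • x ∈ 𝒩 ((i : ℤ) + n))
    (hNA : ∀ (n : ℤ) (j : ℕ), ∀ x ∈ 𝒩 n, ∀ a ∈ 𝒜 j, MulOpposite.op a • x ∈ 𝒩 (n + (j : ℤ)))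
    (hNoethN : IsNoetherian A N) (hNoethNop : IsNoetherian Aᵐᵒᵖ N)
    -- neither `M` nor `N` is torsion as a right `A`-module
    (hMnt : ¬ (∀ x : M, ∃ n0 : ℕ, ∀ m : ℕ, n0 ≤ m → ∀ a ∈ 𝒜 m, MulOpposite.op a • x = 0))
    (hNnt : ¬ (∀ y : N, ∃ n0 : ℕ, ∀ m : ℕ, n0 ≤ m → ∀ a ∈ 𝒜 m, MulOpposite.op a • y = 0)) :
    -- the span of the homogeneous right `A`-module maps `M → N` (equivalently
    -- `⊕_{d ∈ ℤ} Hom_{gr-A}(M, N(d))`) is infinite dimensional over `k`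
    ¬ FiniteDimensional k
        (Submodule.span k
          {f : M →ₗ[Aᵐᵒᵖ] N | ∃ d : ℤ, ∀ i : ℤ, ∀ x ∈ ℳ i, f x ∈ 𝒩 (d + i)}) := by
  intro hfin
  have hp := MulOpposite.eq_zero_or_eq_zero_of_forall (hps.eq_zero_or_eq_zero hlfA)
  have : IsNoetherianRing Aᵐᵒᵖᵐᵒᵖ := isNoetherianRing_of_ringEquiv A (RingEquiv.opOp A)
  have hA : ¬ FiniteDimensional k Aᵐᵒᵖ := fun h =>
    hps.1 (Module.Finite.equiv (MulOpposite.opLinearEquiv k (M := A)).symm)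
  have : Nontrivial Aᵐᵒᵖ := by
    by_contra h
    rw [not_nontrivial_iff_subsingleton] at h
    exact hA inferInstance
  obtain ⟨m₀, hm₀⟩ : ∃ m : M, ¬ IsEssentialIdeal ((⊥ : Submodule Aᵐᵒᵖ M).transporter Aᵐᵒᵖ m) := by
    by_contra! h
    obtain ⟨s, hs0, hs⟩ := exists_ne_zero_forall_smul_eq_zero (A := A) h
    exact hs0 (hps.eq_zero_of_forall_smul_eq_zero hMA hMnt hs)
  obtain ⟨g, hg⟩ := exists_linearMap_ne_zero hp hm₀
  have htop : Submodule.span k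
      {f : M →ₗ[Aᵐᵒᵖ] N | ∃ d : ℤ, ∀ i : ℤ, ∀ x ∈ ℳ i, f x ∈ 𝒩 (d + i)} = ⊤ :=
    eq_top_iff.2 fun f _ => mem_span_homogeneous hMA hNA f
  rw [htop] at hfin
  exact hA (finiteDimensional_of_finiteDimensional_linearMap (A := A) hp
    (fun t ht => hps.eq_zero_of_forall_smul_eq_zero hNA hNnt ht) hg
    (Module.Finite.equiv Submodule.topEquiv))
end

section
/- Let D_1, …, D_h be division rings of characteristic zero (division algebras over ℚ), fix positive integers n_1, …, n_h, and let M be an element of the product ring R = M_{n_1}(D_1) × ⋯ × M_{n_h}(D_h). (i) If M is unipotent, then for every integer p ≥ 1 there is a unit U ∈ R with M^p = U M U^{-1}, i.e. M^p is conjugate to M. (ii) If M is quasi-unipotent, then there exist integers 0 < p < q and a unit U ∈ R with M^p = U M^q U^{-1}, i.e. M^p is conjugate to M^q. -/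
/-- Over a division ring, a nilpotent endomorphism `N` of a finite-dimensional space is conjugate to
`N ∘ w` for every injective endomorphism `w` commuting with `N`. -/
theorem exists_injective_intertwining_of_pow_eq_zero {K : Type*} [DivisionRing K] (k : ℕ) :
    ∀ {V : Type*} [AddCommGroup V] [Module K V] [FiniteDimensional K V] (N w : V →ₗ[K] V),
      (∀ x, N (w x) = w (N x)) → Function.Injective w → (∀ x, (N ^ k) x = 0) →
      ∃ g : V →ₗ[K] V, Function.Injective g ∧ ∀ x, g (N x) = N (w (g x)) := by
  induction k with
  | zero =>
    intro V _ _ _ N w _ _ h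
    have h0 : ∀ x : V, x = 0 := fun x => by simpa using h x
    exact ⟨LinearMap.id, fun x y _ => by rw [h0 x, h0 y], fun x => by
      rw [h0 (LinearMap.id (N x)), h0 (N _)]⟩
  | succ k ih =>
    intro V _ _ _ N w hNw hw h
    let W := LinearMap.range N
    have hNW : ∀ x ∈ W, N x ∈ W := fun x _ => ⟨x, rfl⟩
    have hwW : ∀ x ∈ W, w x ∈ W := by
      rintro _ ⟨y, rfl⟩
      exact ⟨w y, hNw y⟩
    obtain ⟨g, hg, hgN⟩ := ih (V := W) (N.restrict hNW) (w.restrict hwW)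
      (fun x => Subtype.ext (hNw x))
      (fun x y hxy => Subtype.ext (hw (congrArg Subtype.val hxy)))
      (by
        rintro ⟨_, y, rfl⟩
        rw [Module.End.pow_restrict]
        ext
        simpa [pow_succ] using h y)
    have hgN' : ∀ x : W, (g ⟨N x, hNW x x.2⟩ : V) = N (w (g x)) := fun x =>
      congrArg Subtype.val (hgN x)
    -- A complement `C` of `W` that splits the kernel of `N`.
    obtain ⟨Q, hQ⟩ := Submodule.exists_isCompl (LinearMap.ker N ⊓ W)
    have hdis : Disjoint W (Q ⊓ LinearMap.ker N) := by
      rw [Submodule.disjoint_def]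
      intro x hxW hx
      exact Submodule.disjoint_def.1 hQ.disjoint x ⟨hx.2, hxW⟩ hx.1
    obtain ⟨C, hC, hWC⟩ := hdis.symm.exists_isCompl
    obtain ⟨π, hπW, hπK⟩ : ∃ π : V →ₗ[K] W, (∀ x : W, π x = x) ∧
        ∀ x, N x = 0 → N (π x) = 0 := by
      refine ⟨W.projectionOnto C hWC.symm, W.projectionOnto_apply_left _, fun x hx => ?_⟩
      obtain ⟨a, ha, b, hb, rfl⟩ := Submodule.mem_sup.1 (hQ.sup_eq_top ▸ Submodule.mem_top (x := x))
      have hNa : N a = 0 := ha.1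
      have hbC : b ∈ C := hC ⟨hb, by simpa [hNa] using hx⟩
      rw [map_add, Submodule.projectionOnto_apply_of_mem_left _ ha.2,
        (Submodule.projectionOnto_apply_eq_zero_iff _).2 hbC, add_zero]
      exact hNa
    obtain ⟨τ, hτ⟩ := (LinearMap.ker N).subtype.exists_leftInverse_of_injective
      (LinearMap.ker_eq_bot.2 Subtype.val_injective)
    have hτ' : ∀ x, (hx : N x = 0) → (τ x : V) = x := fun x hx =>
      congrArg Subtype.val (LinearMap.congr_fun hτ ⟨x, hx⟩)
    have hws : Function.Surjective w := LinearMap.injective_iff_surjective.1 hw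
    obtain ⟨s, hs⟩ := (N.rangeRestrict ∘ₗ w).exists_rightInverse_of_surjective
      (LinearMap.range_eq_top.2 (N.surjective_rangeRestrict.comp hws))
    have hs' : ∀ x : W, N (w (s x)) = x := fun x =>
      congrArg Subtype.val (LinearMap.congr_fun hs x)
    let f : V →ₗ[K] V := W.subtype ∘ₗ g ∘ₗ π +
      (s ∘ₗ g ∘ₗ N.rangeRestrict + (LinearMap.ker N).subtype ∘ₗ τ) ∘ₗ
        (LinearMap.id - W.subtype ∘ₗ π)
    have hf : ∀ x, f x = g (π x) + (s (g (N.rangeRestrict (x - π x))) + τ (x - π x)) :=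
      fun x => rfl
    have hfW : ∀ x : W, f x = g x := by
      intro x
      rw [hf, hπW]
      simp
    have hfN : ∀ x, f (N x) = N (w (f x)) := by
      intro x
      have h1 : f (N x) = g (N.rangeRestrict x) := hfW ⟨N x, x, rfl⟩
      have h2 : N (w (τ (x - π x))) = 0 := by
        rw [hNw, (τ (x - π x)).2, map_zero]
      rw [h1, hf, map_add, map_add, map_add, map_add, hs', h2, add_zero, ← hgN',
        ← Submodule.coe_add, ← map_add]
      congr 2
      ext
      simp
    refine ⟨f, ?_, hfN⟩
    rw [injective_iff_map_eq_zero]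
    intro x hx
    have hNx : N x = 0 := by
      have h1 : (g (N.rangeRestrict x) : V) = 0 := by
        rw [← hfW (N.rangeRestrict x)]
        change f (N x) = 0
        rw [hfN, hx, map_zero, map_zero]
      have h2 : N.rangeRestrict x = 0 := (injective_iff_map_eq_zero g).1 hg _ (Subtype.ext h1)
      exact congrArg Subtype.val h2
    have hNy : N (x - π x) = 0 := by rw [map_sub, hNx, hπK x hNx, sub_zero]
    have hRy : N.rangeRestrict (x - π x) = 0 := Subtype.ext hNy
    have hfx : f x = g (π x) + (x - π x) := by
      rw [hf, hτ' _ hNy, hRy]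
      simp
    have h3 : g (π x) = 0 := by
      have := congrArg π (hfx.symm.trans hx)
      simpa [hπW] using this
    have h4 : π x = 0 := (injective_iff_map_eq_zero g).1 hg _ h3
    simpa [hfx, h4] using hx

/-- A nilpotent square matrix over a division ring is conjugate to its product with any unit that
commutes with it. -/
theorem Matrix.exists_unit_mul_eq_of_isNilpotent {K : Type*} [DivisionRing K] {m : Type*}
    [Fintype m] [DecidableEq m] {A B : Matrix m m K} (hA : IsNilpotent A) (hB : IsUnit B)
    (hAB : Commute A B) : ∃ U : (Matrix m m K)ˣ, A * U = U * (B * A) := by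
  obtain ⟨k, hk⟩ := hA
  have hpow : ∀ (j : ℕ) (x : m → K), (A.toLinearMapRight' ^ j) x = Matrix.vecMul x (A ^ j) := by
    intro j
    induction j with
    | zero => simp
    | succ j ih => intro x; rw [pow_succ, Module.End.mul_apply, ih, pow_succ']; simp
  obtain ⟨g, hg, hgA⟩ := exists_injective_intertwining_of_pow_eq_zero k A.toLinearMapRight'
    B.toLinearMapRight' (fun x => by simp [hAB.eq])
    (by
      obtain ⟨B, rfl⟩ := hB
      intro x y hxy
      simpa using congrArg (fun z => Matrix.vecMul z (B⁻¹).val) hxy)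
    (fun x => by rw [hpow, hk]; simp)
  let e := LinearEquiv.ofInjectiveEndo g hg
  refine ⟨⟨g.toMatrixRight', e.symm.toLinearMap.toMatrixRight', ?_, ?_⟩, ?_⟩
  · rw [← LinearMap.toMatrixRight'_comp, ← LinearMap.toMatrixRight'_id]
    congr 1
    exact LinearMap.ext e.symm_apply_apply
  · rw [← LinearMap.toMatrixRight'_comp, ← LinearMap.toMatrixRight'_id]
    congr 1
    exact LinearMap.ext e.apply_symm_apply
  · apply Matrix.toLinearMapRight'.injective
    refine LinearMap.ext fun x => ?_
    simpa using hgA x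

/-- In a ring where `p` is invertible, `u ^ p - 1` is a unit multiple of `u - 1` for unipotent
`u`. -/
theorem isUnit_geom_sum_of_isNilpotent_sub_one {R : Type*} [Ring R] {u : R}
    (hu : IsNilpotent (u - 1)) {p : ℕ} (hp : IsUnit (p : R)) :
    IsUnit (∑ i ∈ Finset.range p, u ^ i) := by
  have hsum : ∑ i ∈ Finset.range p, u ^ i =
      p + (∑ i ∈ Finset.range p, ∑ j ∈ Finset.range i, u ^ j) * (u - 1) := by
    rw [Finset.sum_mul]
    simp [geom_sum_mul]
  have hcomm : Commute (∑ i ∈ Finset.range p, ∑ j ∈ Finset.range i, u ^ j) (u - 1) :=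
    Commute.sum_left _ _ _ fun i _ => Commute.sum_left _ _ _ fun j _ =>
      ((Commute.refl u).sub_right (Commute.one_right u)).pow_left j
  rw [hsum]
  exact (hcomm.isNilpotent_mul_left hu).isUnit_add_left_of_commute hp (Nat.cast_commute _ _).symm

/-- A unipotent matrix over a division ring of characteristic zero is conjugate to its positive
powers. -/
theorem Matrix.exists_unit_pow_eq_of_isNilpotent_sub_one {K : Type*} [DivisionRing K] [CharZero K]
    {m : Type*} [Fintype m] [DecidableEq m] {M : Matrix m m K} (hM : IsNilpotent (M - 1)) {p : ℕ}
    (hp : 1 ≤ p) : ∃ U : (Matrix m m K)ˣ, M ^ p = U * M * (↑U⁻¹ : Matrix m m K) := by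
  have hpu : IsUnit (p : Matrix m m K) := by
    have : IsUnit (p : K) := (Nat.cast_ne_zero.2 (by lia)).isUnit
    simpa using this.map (Matrix.scalar m)
  obtain ⟨U, hU⟩ := Matrix.exists_unit_mul_eq_of_isNilpotent hM
    (isUnit_geom_sum_of_isNilpotent_sub_one hM hpu)
    (Commute.sum_right _ _ _ fun i _ =>
      ((Commute.refl M).sub_left (Commute.one_left M)).pow_right i)
  rw [geom_sum_mul, sub_mul, mul_sub, one_mul, mul_one, sub_left_inj] at hU
  refine ⟨U⁻¹, ?_⟩
  rw [inv_inv, mul_assoc, hU, Units.inv_mul_cancel_left]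

/-- In a product of matrix rings over division rings of characteristic zero, a unipotent element is
conjugate to its positive powers. -/
theorem Pi.exists_unit_pow_eq_of_isNilpotent_sub_one {ι : Type*} {D : ι → Type*}
    [∀ i, DivisionRing (D i)] [∀ i, CharZero (D i)] {m : ι → Type*} [∀ i, Fintype (m i)]
    [∀ i, DecidableEq (m i)] {M : ∀ i, Matrix (m i) (m i) (D i)} (hM : IsNilpotent (M - 1)) {p : ℕ}
    (hp : 1 ≤ p) :
    ∃ U : (∀ i, Matrix (m i) (m i) (D i))ˣ,
      M ^ p = (U : ∀ i, Matrix (m i) (m i) (D i)) * M * (↑U⁻¹) := by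
  have hMi : ∀ i, IsNilpotent (M i - 1) := fun i =>
    hM.map (Pi.evalRingHom (fun i => Matrix (m i) (m i) (D i)) i)
  choose U hU using fun i => Matrix.exists_unit_pow_eq_of_isNilpotent_sub_one (hMi i) hp
  exact ⟨MulEquiv.piUnits.symm U, funext hU⟩

theorem unipotent_conjugate_powers
    {h : ℕ} (D : Fin h → Type*) [∀ i, DivisionRing (D i)] [∀ i, CharZero (D i)]
    (n : Fin h → ℕ) (hn : ∀ i, 0 < n i)
    (M : ∀ i, Matrix (Fin (n i)) (Fin (n i)) (D i)) :
    -- (i)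
    (IsNilpotent (M - 1) →
      ∀ p : ℕ, 1 ≤ p →
        ∃ U : (∀ i, Matrix (Fin (n i)) (Fin (n i)) (D i))ˣ,
          M ^ p = (U : ∀ i, Matrix (Fin (n i)) (Fin (n i)) (D i)) * M * (↑U⁻¹)) ∧
    -- (ii)
    ((∃ s : ℕ, 1 ≤ s ∧ IsNilpotent (M ^ s - 1)) →
      ∃ p q : ℕ, 0 < p ∧ p < q ∧
        ∃ U : (∀ i, Matrix (Fin (n i)) (Fin (n i)) (D i))ˣ,
          M ^ p = (U : ∀ i, Matrix (Fin (n i)) (Fin (n i)) (D i)) * M ^ q * (↑U⁻¹)) := by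
  refine ⟨fun hM p hp => Pi.exists_unit_pow_eq_of_isNilpotent_sub_one hM hp, ?_⟩
  rintro ⟨s, hs, hM⟩
  obtain ⟨U, hU⟩ := Pi.exists_unit_pow_eq_of_isNilpotent_sub_one hM one_le_two
  refine ⟨s, s * 2, by lia, by lia, U⁻¹, ?_⟩
  rw [pow_mul, hU, inv_inv, mul_assoc (U : ∀ i, Matrix (Fin (n i)) (Fin (n i)) (D i)),
    Units.inv_mul_cancel_left, Units.inv_mul_cancel_right]
end
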